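/- The square of the 7-cycle admits a star 7-edge-coloring; that is, χ'_star(C_7²) ≤ 7. -/

import Mathlib

/-- A star `k`-edge-coloring of `G`: a proper edge-coloring (adjacent edges get
distinct colors) such that no path and no cycle with exactly four edges is
bicolored.  The walks `v₀v₁v₂v₃v₄` with consecutive vertices adjacent and with
`v₀,v₁,v₂,v₃` pairwise distinct and `v₁,v₂,v₃,v₄` pairwise distinct are exactly
the paths (when `v₀ ≠ v₄`) and cycles (when `v₀ = v₄`) with four edges; being
bicolored under a proper coloring means the colors alternate. -/
def IsStarEdgeColoring {V : Type*} (G : SimpleGraph V) {k : ℕ} (c : Sym2 V → Fin k) : Prop :=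
  (∀ ⦃u v w : V⦄, G.Adj u v → G.Adj u w → v ≠ w → c s(u, v) ≠ c s(u, w)) ∧
  (∀ v₀ v₁ v₂ v₃ v₄ : V, G.Adj v₀ v₁ → G.Adj v₁ v₂ → G.Adj v₂ v₃ → G.Adj v₃ v₄ →
    v₀ ≠ v₂ → v₀ ≠ v₃ → v₁ ≠ v₃ → v₁ ≠ v₄ → v₂ ≠ v₄ →
    ¬(c s(v₀, v₁) = c s(v₂, v₃) ∧ c s(v₁, v₂) = c s(v₃, v₄)))

/-- The star chromatic index of `G`: the least `k` such that `G` admits a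
star `k`-edge-coloring. -/
noncomputable def starChromaticIndex {V : Type*} (G : SimpleGraph V) : ℕ :=
  sInf {k : ℕ | ∃ c : Sym2 V → Fin k, IsStarEdgeColoring G c}

/-- The square `Cₙ²` of the cycle on `n` vertices: vertices `ZMod n`, with `i`
adjacent to `j` iff `i ≠ j` and `i - j ≡ ±1` or `±2 (mod n)`. -/
def cycleSq (n : ℕ) : SimpleGraph (ZMod n) :=
  SimpleGraph.fromRel (fun a b => a - b = 1 ∨ a - b = 2)

/-- The edge-coloring `{a, b} ↦ a + b + 3 (a - b)²` of the complete graph on `ZMod 7`. -/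
def quadraticColoring : Sym2 (ZMod 7) → Fin 7 :=
  Sym2.lift ⟨fun a b => (a + b + 3 * (a - b) ^ 2 : ZMod 7), fun a b =>
    show (a + b + 3 * (a - b) ^ 2 : ZMod 7) = b + a + 3 * (b - a) ^ 2 by ring⟩

instance (n : ℕ) : DecidableRel (cycleSq n).Adj := fun a b =>
  inferInstanceAs (Decidable (a ≠ b ∧ ((a - b = 1 ∨ a - b = 2) ∨ (b - a = 1 ∨ b - a = 2))))

theorem isStarEdgeColoring_quadraticColoring :
    IsStarEdgeColoring (cycleSq 7) quadraticColoring := by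
  have proper : ∀ u v : ZMod 7, (cycleSq 7).Adj u v → ∀ w, (cycleSq 7).Adj u w → v ≠ w →
      quadraticColoring s(u, v) ≠ quadraticColoring s(u, w) := by
    decide +kernel
  have star : ∀ v₀ v₁ : ZMod 7, (cycleSq 7).Adj v₀ v₁ → ∀ v₂, (cycleSq 7).Adj v₁ v₂ →
      v₀ ≠ v₂ → ∀ v₃, (cycleSq 7).Adj v₂ v₃ → v₀ ≠ v₃ → v₁ ≠ v₃ →
      quadraticColoring s(v₀, v₁) = quadraticColoring s(v₂, v₃) →
      ∀ v₄, (cycleSq 7).Adj v₃ v₄ → v₁ ≠ v₄ → v₂ ≠ v₄ →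
      quadraticColoring s(v₁, v₂) ≠ quadraticColoring s(v₃, v₄) := by
    decide +kernel
  exact ⟨fun u v w huv huw => proper u v huv w huw,
    fun v₀ v₁ v₂ v₃ v₄ h₀ h₁ h₂ h₃ h₀₂ h₀₃ h₁₃ h₁₄ h₂₄ ⟨heq, heq'⟩ =>
      star v₀ v₁ h₀ v₂ h₁ h₀₂ v₃ h₂ h₀₃ h₁₃ heq v₄ h₃ h₁₄ h₂₄ heq'⟩

/-- `χ'_star(C₇²) ≤ 7`: the square of the 7-cycle admits a star 7-edge-coloring. -/
theorem starChromaticIndex_cycleSq_seven : starChromaticIndex (cycleSq 7) ≤ 7 :=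
  Nat.sInf_le ⟨quadraticColoring, isStarEdgeColoring_quadraticColoring⟩
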